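/- On ℝ² with the Euclidean cometric g, the Poisson bivector Π ∂₁∧∂₂ and the associated contravariant Levi-Civita connection D, for every smooth 1-form η and all smooth 1-forms α, β one has (L_η(L_η g))(α,β) = g(D_ηD_αη − D_{[η,α]_Π}η, β) + g(D_ηD_βη − D_{[η,β]_Π}η, α) + 2g(D_αη, D_βη). -/

import Mathlib

noncomputable section

/-- Smooth scalar functions on `ℝ²`. -/
abbrev Fn : Type := (ℝ × ℝ) → ℝ

/-- A 1-form on `ℝ²` identified with its pair of component functions. -/
abbrev OneForm : Type := Fn × Fn

/-- Partial derivative in the first coordinate direction. -/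
def pd1 (f : Fn) : Fn := fun p => fderiv ℝ f p (1, 0)

/-- Partial derivative in the second coordinate direction. -/
def pd2 (f : Fn) : Fn := fun p => fderiv ℝ f p (0, 1)

/-- Smoothness of a function. -/
def SmoothFn (f : Fn) : Prop := ContDiff ℝ (⊤ : ℕ∞) f

/-- Smoothness of a 1-form. -/
def SmoothForm (ω : OneForm) : Prop := SmoothFn ω.1 ∧ SmoothFn ω.2

/-- The Euclidean cometric on 1-forms. -/
def gmet (ω τ : OneForm) : Fn := fun p => ω.1 p * τ.1 p + ω.2 p * τ.2 p

/-- The sharp map `♯(ω)` acting on a function. -/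
def sharpF (Pi : Fn) (ω : OneForm) (f : Fn) : Fn :=
  fun p => Pi p * (ω.1 p * pd2 f p - ω.2 p * pd1 f p)

/-- The contravariant Levi-Civita connection associated with `(g, Π)`. -/
def Dconn (Pi : Fn) (ω τ : OneForm) : OneForm :=
  (fun p => sharpF Pi ω τ.1 p + (ω.1 p * pd1 Pi p + ω.2 p * pd2 Pi p) * τ.2 p,
   fun p => sharpF Pi ω τ.2 p - (ω.1 p * pd1 Pi p + ω.2 p * pd2 Pi p) * τ.1 p)

/-- The sharp map as a vector field `(X¹, X²)`. -/
def sharpVF (Pi : Fn) (ω : OneForm) : Fn × Fn :=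
  (fun p => -(Pi p) * ω.2 p, fun p => Pi p * ω.1 p)

/-- Lie derivative of a 1-form along a vector field. -/
def lieVF (X : Fn × Fn) (τ : OneForm) : OneForm :=
  (fun p => X.1 p * pd1 τ.1 p + X.2 p * pd2 τ.1 p + τ.1 p * pd1 X.1 p + τ.2 p * pd1 X.2 p,
   fun p => X.1 p * pd1 τ.2 p + X.2 p * pd2 τ.2 p + τ.1 p * pd2 X.1 p + τ.2 p * pd2 X.2 p)

/-- The bivector evaluated on two 1-forms: `Π(ω,τ) = Π·(ω₁τ₂ − ω₂τ₁)`. -/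
def PiForm (Pi : Fn) (ω τ : OneForm) : Fn :=
  fun p => Pi p * (ω.1 p * τ.2 p - ω.2 p * τ.1 p)

/-- The exterior differential of a function, as a 1-form. -/
def dF (f : Fn) : OneForm := (pd1 f, pd2 f)

/-- The Koszul bracket of 1-forms. -/
def koszul (Pi : Fn) (ω τ : OneForm) : OneForm :=
  lieVF (sharpVF Pi ω) τ - lieVF (sharpVF Pi τ) ω - dF (PiForm Pi ω τ)

/-- Lie derivative of the cometric `g` along a 1-form `η`. -/
def lieG (Pi : Fn) (η α β : OneForm) : Fn :=
  fun p => sharpF Pi η (gmet α β) p - gmet (koszul Pi η α) β p - gmet α (koszul Pi η β) p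

/-- Second Lie derivative `(L_η (L_η g))(α, β)`. -/
def lie2G (Pi : Fn) (η α β : OneForm) : Fn :=
  fun p => sharpF Pi η (lieG Pi η α β) p - lieG Pi η (koszul Pi η α) β p
    - lieG Pi η α (koszul Pi η β) p

/-- `η` is a Killing 1-form. -/
def IsKilling (Pi : Fn) (η : OneForm) : Prop :=
  ∀ α β : OneForm, SmoothForm α → SmoothForm β → lieG Pi η α β = 0

/-- `η` is a 2-Killing 1-form. -/
def Is2Killing (Pi : Fn) (η : OneForm) : Prop :=
  ∀ α β : OneForm, SmoothForm α → SmoothForm β → lie2G Pi η α β = 0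

/-- Curvature of the contravariant connection. -/
def curv (Pi : Fn) (ω τ γ : OneForm) : OneForm :=
  Dconn Pi ω (Dconn Pi τ γ) - Dconn Pi τ (Dconn Pi ω γ) - Dconn Pi (koszul Pi ω τ) γ

/-- The coordinate 1-form `dx¹`. -/
def dx1 : OneForm := (fun _ => 1, fun _ => 0)

/-- The coordinate 1-form `dx²`. -/
def dx2 : OneForm := (fun _ => 0, fun _ => 1)

/-- Contravariant Laplacian on functions. -/
def lapF (Pi : Fn) (f : Fn) : Fn :=
  fun p => -((sharpF Pi dx1 (sharpF Pi dx1 f) p - sharpF Pi (Dconn Pi dx1 dx1) f p)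
    + (sharpF Pi dx2 (sharpF Pi dx2 f) p - sharpF Pi (Dconn Pi dx2 dx2) f p))

/-- Contravariant Laplacian on 1-forms. -/
def lapO (Pi : Fn) (η : OneForm) : OneForm :=
  -((Dconn Pi dx1 (Dconn Pi dx1 η) - Dconn Pi (Dconn Pi dx1 dx1) η)
    + (Dconn Pi dx2 (Dconn Pi dx2 η) - Dconn Pi (Dconn Pi dx2 dx2) η))

theorem SmoothFn.differentiableAt {f : Fn} (hf : SmoothFn f) (p : ℝ × ℝ) :
    DifferentiableAt ℝ f p :=
  ContDiff.contDiffAt hf |>.differentiableAt (by simp)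

theorem SmoothFn.fderiv_apply {f : Fn} (hf : SmoothFn f) (v : ℝ × ℝ) :
    SmoothFn fun p => fderiv ℝ f p v :=
  (ContDiff.fderiv_right (m := (⊤ : ℕ∞)) hf (by simp)).clm_apply contDiff_const

theorem SmoothFn.pd1 {f : Fn} (hf : SmoothFn f) : SmoothFn (pd1 f) :=
  hf.fderiv_apply (1, 0)

theorem SmoothFn.pd2 {f : Fn} (hf : SmoothFn f) : SmoothFn (pd2 f) :=
  hf.fderiv_apply (0, 1)

theorem SmoothFn.add {f g : Fn} (hf : SmoothFn f) (hg : SmoothFn g) :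
    SmoothFn fun p => f p + g p :=
  ContDiff.add hf hg

theorem SmoothFn.sub {f g : Fn} (hf : SmoothFn f) (hg : SmoothFn g) :
    SmoothFn fun p => f p - g p :=
  ContDiff.sub hf hg

theorem SmoothFn.mul {f g : Fn} (hf : SmoothFn f) (hg : SmoothFn g) :
    SmoothFn fun p => f p * g p :=
  ContDiff.mul hf hg

theorem SmoothFn.neg {f : Fn} (hf : SmoothFn f) : SmoothFn fun p => -f p :=
  ContDiff.neg hf

theorem SmoothFn.sharpF {Pi f : Fn} {ω : OneForm} (hPi : SmoothFn Pi) (hω : SmoothForm ω)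
    (hf : SmoothFn f) : SmoothFn (sharpF Pi ω f) :=
  hPi.mul ((hω.1.mul hf.pd2).sub (hω.2.mul hf.pd1))

theorem SmoothForm.sub {ω τ : OneForm} (hω : SmoothForm ω) (hτ : SmoothForm τ) :
    SmoothForm (ω - τ) :=
  ⟨hω.1.sub hτ.1, hω.2.sub hτ.2⟩

theorem SmoothForm.dconn {Pi : Fn} {ω τ : OneForm} (hPi : SmoothFn Pi) (hω : SmoothForm ω)
    (hτ : SmoothForm τ) : SmoothForm (Dconn Pi ω τ) :=
  have h := (hω.1.mul hPi.pd1).add (hω.2.mul hPi.pd2)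
  ⟨(hPi.sharpF hω hτ.1).add (h.mul hτ.2), (hPi.sharpF hω hτ.2).sub (h.mul hτ.1)⟩

theorem SmoothFn.gmet {ω τ : OneForm} (hω : SmoothForm ω) (hτ : SmoothForm τ) :
    SmoothFn (gmet ω τ) :=
  (hω.1.mul hτ.1).add (hω.2.mul hτ.2)

theorem fderiv_mul_apply {f g : Fn} (hf : SmoothFn f) (hg : SmoothFn g) (p v : ℝ × ℝ) :
    fderiv ℝ (fun q => f q * g q) p v = f p * fderiv ℝ g p v + g p * fderiv ℝ f p v := by
  rw [fderiv_fun_mul (hf.differentiableAt p) (hg.differentiableAt p)]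
  simp

theorem fderiv_add_apply {f g : Fn} (hf : SmoothFn f) (hg : SmoothFn g) (p v : ℝ × ℝ) :
    fderiv ℝ (fun q => f q + g q) p v = fderiv ℝ f p v + fderiv ℝ g p v := by
  rw [fderiv_fun_add (hf.differentiableAt p) (hg.differentiableAt p)]
  simp

theorem fderiv_sub_apply {f g : Fn} (hf : SmoothFn f) (hg : SmoothFn g) (p v : ℝ × ℝ) :
    fderiv ℝ (fun q => f q - g q) p v = fderiv ℝ f p v - fderiv ℝ g p v := by
  rw [fderiv_fun_sub (hf.differentiableAt p) (hg.differentiableAt p)]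
  simp

theorem fderiv_neg_apply (f : Fn) (p v : ℝ × ℝ) :
    fderiv ℝ (fun q => -f q) p v = -fderiv ℝ f p v := by
  rw [fderiv_fun_neg]
  simp

theorem sharpF_add {f g : Fn} (Pi : Fn) (ω : OneForm) (hf : SmoothFn f) (hg : SmoothFn g)
    (p : ℝ × ℝ) :
    sharpF Pi ω (fun q => f q + g q) p = sharpF Pi ω f p + sharpF Pi ω g p := by
  simp only [sharpF, pd1, pd2, fderiv_add_apply hf hg]
  ring

/-- The contravariant Levi-Civita connection is metric. -/
theorem sharpF_gmet {ω τ : OneForm} (Pi : Fn) (η : OneForm) (hω : SmoothForm ω)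
    (hτ : SmoothForm τ) (p : ℝ × ℝ) :
    sharpF Pi η (gmet ω τ) p = gmet (Dconn Pi η ω) τ p + gmet ω (Dconn Pi η τ) p := by
  unfold gmet
  simp only [sharpF, Dconn, pd1, pd2,
    fderiv_add_apply (hω.1.mul hτ.1) (hω.2.mul hτ.2), fderiv_mul_apply hω.1 hτ.1,
    fderiv_mul_apply hω.2 hτ.2]
  ring

/-- The contravariant Levi-Civita connection is torsion-free. -/
theorem koszul_eq_dconn_sub {Pi : Fn} {ω τ : OneForm} (hPi : SmoothFn Pi) (hω : SmoothForm ω)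
    (hτ : SmoothForm τ) : koszul Pi ω τ = Dconn Pi ω τ - Dconn Pi τ ω := by
  have hsub := fderiv_sub_apply (hω.1.mul hτ.2) (hω.2.mul hτ.1)
  have hPiForm := fderiv_mul_apply hPi ((hω.1.mul hτ.2).sub (hω.2.mul hτ.1))
  unfold koszul PiForm
  ext p <;>
  · simp only [lieVF, sharpVF, dF, Dconn, sharpF, pd1, pd2, Prod.fst_sub,
      Prod.snd_sub, _root_.Pi.sub_apply, hPiForm, hsub, fderiv_mul_apply hω.1 hτ.2,
      fderiv_mul_apply hω.2 hτ.1, fderiv_mul_apply hPi hω.1, fderiv_mul_apply hPi hτ.1,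
      fderiv_mul_apply hPi.neg hω.2, fderiv_mul_apply hPi.neg hτ.2, fderiv_neg_apply]
    ring

theorem SmoothForm.koszul {Pi : Fn} {ω τ : OneForm} (hPi : SmoothFn Pi) (hω : SmoothForm ω)
    (hτ : SmoothForm τ) : SmoothForm (koszul Pi ω τ) := by
  rw [koszul_eq_dconn_sub hPi hω hτ]
  exact (SmoothForm.dconn hPi hω hτ).sub (SmoothForm.dconn hPi hτ hω)

/-- The Lie derivative of the cometric is the symmetrized covariant derivative of `η`. -/
theorem lieG_eq {Pi : Fn} {η α β : OneForm} (hPi : SmoothFn Pi) (hη : SmoothForm η)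
    (hα : SmoothForm α) (hβ : SmoothForm β) :
    lieG Pi η α β = fun p => gmet (Dconn Pi α η) β p + gmet α (Dconn Pi β η) p := by
  funext p
  rw [lieG, sharpF_gmet Pi η hα hβ, koszul_eq_dconn_sub hPi hη hα, koszul_eq_dconn_sub hPi hη hβ]
  simp only [gmet, Prod.fst_sub, Prod.snd_sub, _root_.Pi.sub_apply]
  ring

theorem second_lie_derivative_formula (Pi : Fn) (hPi : SmoothFn Pi)
    (η : OneForm) (hη : SmoothForm η) :
    ∀ α β : OneForm, SmoothForm α → SmoothForm β →
      lie2G Pi η α β = fun p =>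
        gmet (Dconn Pi η (Dconn Pi α η) - Dconn Pi (koszul Pi η α) η) β p
        + gmet (Dconn Pi η (Dconn Pi β η) - Dconn Pi (koszul Pi η β) η) α p
        + 2 * gmet (Dconn Pi α η) (Dconn Pi β η) p := by
  intro α β hα hβ
  have hDα := SmoothForm.dconn hPi hα hη
  have hDβ := SmoothForm.dconn hPi hβ hη
  funext p
  rw [lie2G, lieG_eq hPi hη hα hβ, lieG_eq hPi hη (.koszul hPi hη hα) hβ,
    lieG_eq hPi hη hα (.koszul hPi hη hβ),
    sharpF_add Pi η (.gmet hDα hβ) (.gmet hα hDβ), sharpF_gmet Pi η hDα hβ,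
    sharpF_gmet Pi η hα hDβ]
  have hKα := koszul_eq_dconn_sub hPi hη hα
  have hKβ := koszul_eq_dconn_sub hPi hη hβ
  have hα₁ := congrFun (congrArg Prod.fst hKα) p
  have hα₂ := congrFun (congrArg Prod.snd hKα) p
  have hβ₁ := congrFun (congrArg Prod.fst hKβ) p
  have hβ₂ := congrFun (congrArg Prod.snd hKβ) p
  simp only [Prod.fst_sub, Prod.snd_sub, _root_.Pi.sub_apply] at hα₁ hα₂ hβ₁ hβ₂
  simp only [gmet, Prod.fst_sub, Prod.snd_sub, _root_.Pi.sub_apply, hα₁, hα₂, hβ₁, hβ₂]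
  ring

end
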